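/- Fix integers m ≥ 2 and n ≥ 0, and let A be a real number with 2n(2n+m−1) < A ≤ (2n+2)(2n+2+m−1). If w is a normalized solution of the linearized equation with parameter A, then the set {t ∈ (0,π/2) : w'(t) = 0} is finite and has exactly n elements. -/

import Mathlib

open Real Set

/-- `w` is a normalized solution of the linearized equation
`w'' + (m-1) (cos t / sin t) w' + A w = 0` on `(0, π)`,
with `w(0) = 1` and `w'(0) = 0`. -/
def IsNormalizedLinSolution (m : ℕ) (A : ℝ) (w : ℝ → ℝ) : Prop :=
  ContinuousOn w (Set.Icc 0 π) ∧
  (∀ t ∈ Set.Icc (0 : ℝ) π, DifferentiableAt ℝ w t) ∧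
  (∀ t ∈ Set.Ioo (0 : ℝ) π, DifferentiableAt ℝ (deriv w) t) ∧
  w 0 = 1 ∧ deriv w 0 = 0 ∧
  ∀ t ∈ Set.Ioo (0 : ℝ) π,
    deriv (deriv w) t + ((m : ℝ) - 1) * (Real.cos t / Real.sin t) * deriv w t
      + A * w t = 0

/-- A nontrivial solution `(w, v)` of the first order system `w' = v / sin ^ p`,
`v' = -A sin ^ p w` on `(0, π/2]`, where `v = sin ^ p w'` vanishes at `0`. -/
structure IsLinSystem (p : ℕ) (A : ℝ) (w v : ℝ → ℝ) : Prop where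
  cont_fst : ContinuousOn w (Icc 0 (π / 2))
  cont_snd : ContinuousOn v (Icc 0 (π / 2))
  fst_zero : w 0 ≠ 0
  snd_zero : v 0 = 0
  deriv_fst : ∀ t ∈ Ioc (0 : ℝ) (π / 2), HasDerivAt w (v t / sin t ^ p) t
  deriv_snd : ∀ t ∈ Ioc (0 : ℝ) (π / 2), HasDerivAt v (-A * sin t ^ p * w t) t

namespace IsLinSystem

variable {p : ℕ} {A B : ℝ} {w v W V : ℝ → ℝ}

lemma sin_pos_of_mem {t : ℝ} (ht : t ∈ Ioc (0 : ℝ) (π / 2)) : 0 < sin t :=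
  sin_pos_of_pos_of_lt_pi ht.1 (by linarith [ht.2, pi_pos])

lemma neg (h : IsLinSystem p A w v) : IsLinSystem p A (-w) (-v) where
  cont_fst := h.cont_fst.neg
  cont_snd := h.cont_snd.neg
  fst_zero := by simpa using h.fst_zero
  snd_zero := by simpa using h.snd_zero
  deriv_fst t ht := by
    exact (h.deriv_fst t ht).neg.congr_deriv (by simp [neg_div])
  deriv_snd t ht := by
    exact (h.deriv_snd t ht).neg.congr_deriv (by simp)

lemma fst_ne_zero (h : IsLinSystem p A w v) (hA : 0 < A) {c : ℝ}
    (hc : c ∈ Ioc (0 : ℝ) (π / 2)) (hv : v c = 0) : w c ≠ 0 := by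
  intro hw
  set G : ℝ → ℝ := fun t => v t ^ 2 + A * (sin t ^ p) ^ 2 * w t ^ 2 with hG
  have hsub : Icc 0 c ⊆ Icc 0 (π / 2) := Icc_subset_Icc_right hc.2
  have hw' := h.cont_fst.mono hsub
  have hv' := h.cont_snd.mono hsub
  have hmono : MonotoneOn G (Icc 0 c) := by
    refine monotoneOn_of_hasDerivWithinAt_nonneg (convex_Icc 0 c)
      (f' := fun t => 2 * A * (sin t ^ p * (p * sin t ^ (p - 1) * cos t)) * w t ^ 2)
      (by rw [hG]; fun_prop) ?_ ?_
    · intro t ht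
      rw [interior_Icc] at ht
      have ht' : t ∈ Ioc (0 : ℝ) (π / 2) := ⟨ht.1, ht.2.le.trans hc.2⟩
      have hs := sin_pos_of_mem ht'
      refine (HasDerivAt.congr_deriv (((h.deriv_snd t ht').pow 2).add
        (((((hasDerivAt_sin t).pow p).pow 2).const_mul A).mul
          ((h.deriv_fst t ht').pow 2))) ?_).hasDerivWithinAt
      simp only [Pi.pow_apply]
      field_simp
      ring
    · intro t ht
      rw [interior_Icc] at ht
      have ht' : t ∈ Ioc (0 : ℝ) (π / 2) := ⟨ht.1, ht.2.le.trans hc.2⟩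
      have hs := sin_pos_of_mem ht'
      have hcos : 0 ≤ cos t := cos_nonneg_of_mem_Icc ⟨by linarith [ht.1, pi_pos], ht'.2⟩
      positivity
  have hzero : ∀ t ∈ Ioo 0 c, w t = 0 := by
    intro t ht
    have hs := sin_pos_of_mem (t := t) ⟨ht.1, ht.2.le.trans hc.2⟩
    have h1 : G t ≤ G c := hmono ⟨ht.1.le, ht.2.le⟩ ⟨hc.1.le, le_rfl⟩ ht.2.le
    simp only [hG, hv, hw] at h1
    by_contra hne
    have : 0 < A * (sin t ^ p) ^ 2 * w t ^ 2 := by positivity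
    nlinarith [sq_nonneg (v t)]
  have hclosed : EqOn w 0 (Icc 0 c) := by
    have : EqOn w 0 (Ioo 0 c) := hzero
    exact this.of_subset_closure hw' continuousOn_const Ioo_subset_Icc_self
      (by rw [closure_Ioo hc.1.ne])
  exact h.fst_zero (hclosed ⟨le_rfl, hc.1.le⟩)

/-- Sturm comparison on a nodal interval. -/
lemma comparison_of_pos (h : IsLinSystem p A w v) (H : IsLinSystem p B W V) (hA : 0 < A)
    (hAB : A ≤ B) {a b : ℝ} (ha : 0 ≤ a) (hab : a < b) (hb : b ≤ π / 2) (hva : v a = 0)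
    (hvb : v b = 0) (hv : ∀ t ∈ Ioo a b, 0 < v t) (hV : ∀ t ∈ Ioo a b, 0 < V t) :
    A = B ∧ V b = 0 := by
  have hsub : Icc a b ⊆ Icc 0 (π / 2) := Icc_subset_Icc ha hb
  have hbmem : b ∈ Ioc (0 : ℝ) (π / 2) := ⟨ha.trans_lt hab, hb⟩
  have hVcl : ∀ t ∈ Icc a b, 0 ≤ V t := by
    intro t ht
    have : t ∈ closure (Ioo a b) := by rwa [closure_Ioo hab.ne]
    exact ContinuousWithinAt.closure_le this continuousWithinAt_const
      ((H.cont_snd t (hsub ht)).mono (Ioo_subset_Icc_self.trans hsub))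
      (fun y hy => (hV y hy).le)
  have hwb : 0 < w b := by
    refine lt_of_le_of_ne ?_ (h.fst_ne_zero hA hbmem hvb).symm
    have hs := sin_pos_of_mem hbmem
    have hd := h.deriv_snd b hbmem
    have ht := (hasDerivWithinAt_iff_tendsto_slope' (by simp)).1 (hd.hasDerivWithinAt (s := Iio b))
    have hle : -A * sin b ^ p * w b ≤ 0 := by
      refine le_of_tendsto ht ?_
      filter_upwards [Ioo_mem_nhdsLT hab] with t ht
      rw [slope_def_field, hvb]
      exact div_nonpos_of_nonneg_of_nonpos (by linarith [hv t ht]) (by linarith [ht.2])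
    by_contra! hneg
    have : 0 < A * sin b ^ p * (-w b) := mul_pos (by positivity) (by linarith)
    linarith
  have hwa : A * w a * V a ≤ 0 := by
    rcases ha.eq_or_lt with rfl | ha'
    · simp [H.snd_zero]
    have hamem : a ∈ Ioc (0 : ℝ) (π / 2) := ⟨ha', hab.le.trans hb⟩
    have hs := sin_pos_of_mem hamem
    have hd := h.deriv_snd a hamem
    have ht := (hasDerivWithinAt_iff_tendsto_slope' (by simp)).1 (hd.hasDerivWithinAt (s := Ioi a))
    have hle : 0 ≤ -A * sin a ^ p * w a := by
      refine ge_of_tendsto ht ?_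
      filter_upwards [Ioo_mem_nhdsGT hab] with t ht
      rw [slope_def_field, hva]
      exact div_nonneg (by linarith [hv t ht]) (by linarith [ht.1])
    have hwa : w a ≤ 0 := by
      by_contra! hneg
      have : 0 < A * sin a ^ p * w a := by positivity
      linarith
    exact mul_nonpos_of_nonpos_of_nonneg (mul_nonpos_of_nonneg_of_nonpos hA.le hwa)
      (hVcl a ⟨le_rfl, hab.le⟩)
  have hVb := hVcl b ⟨hab.le, le_rfl⟩
  set f : ℝ → ℝ := fun t => A * w t * V t - B * v t * W t with hf
  have hfa : f a ≤ 0 := by simpa [hf, hva] using hwa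
  have hfb : f b = A * w b * V b := by simp [hf, hvb]
  have hfc : ContinuousOn f (Icc a b) := by
    have h1 := h.cont_fst.mono hsub
    have h2 := h.cont_snd.mono hsub
    have h3 := H.cont_fst.mono hsub
    have h4 := H.cont_snd.mono hsub
    fun_prop
  have hfd : ∀ t ∈ Ioo a b, HasDerivAt f ((A - B) * (v t * V t / sin t ^ p)) t := by
    intro t ht
    have ht' : t ∈ Ioc (0 : ℝ) (π / 2) := ⟨ha.trans_lt ht.1, ht.2.le.trans hb⟩
    have hs := sin_pos_of_mem ht'
    refine ((((h.deriv_fst t ht').const_mul A).mul (H.deriv_snd t ht')).sub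
      (((h.deriv_snd t ht').const_mul B).mul (H.deriv_fst t ht'))).congr_deriv ?_
    field_simp
    ring
  have hpos : ∀ t ∈ Ioo a b, 0 < v t * V t / sin t ^ p := by
    intro t ht
    have hs := sin_pos_of_mem (t := t) ⟨ha.trans_lt ht.1, ht.2.le.trans hb⟩
    have := hv t ht
    have := hV t ht
    positivity
  obtain ⟨c, hc, hceq⟩ := exists_hasDerivAt_eq_slope f _ hab hfc hfd
  rw [eq_div_iff (by linarith)] at hceq
  have hfb' : 0 ≤ f b := by rw [hfb]; positivity
  have hprod := mul_pos (hpos c hc) (sub_pos.2 hab)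
  have hAB' : A = B := by
    by_contra hne
    have : 0 < B - A := sub_pos.2 (lt_of_le_of_ne hAB hne)
    nlinarith [mul_pos this hprod]
  refine ⟨hAB', ?_⟩
  rw [hAB', sub_self, zero_mul, zero_mul] at hceq
  have h0 : A * w b * V b = 0 := by linarith
  exact (mul_eq_zero.1 h0).resolve_left (by positivity)

lemma pos_or_neg_of_ne_zero {f : ℝ → ℝ} {a b : ℝ} (hf : ContinuousOn f (Ioo a b))
    (h0 : ∀ t ∈ Ioo a b, f t ≠ 0) : (∀ t ∈ Ioo a b, 0 < f t) ∨ ∀ t ∈ Ioo a b, 0 < (-f) t := by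
  by_contra! hcon
  obtain ⟨⟨x, hx, hfx⟩, y, hy, hfy⟩ := hcon
  obtain ⟨z, hz, hz0⟩ := isPreconnected_Ioo.intermediate_value hx hy hf
    (show (0 : ℝ) ∈ Icc (f x) (f y) from ⟨hfx, by simpa using hfy⟩)
  exact h0 z hz hz0

lemma exists_nodal_interval (h : IsLinSystem p A w v) (hA : 0 < A) {a b : ℝ} (ha : 0 ≤ a)
    (hab : a < b) (hb : b ≤ π / 2) (hva : v a = 0) (hvb : v b = 0) :
    ∃ a' b', a ≤ a' ∧ a' < b' ∧ b' ≤ b ∧ v a' = 0 ∧ v b' = 0 ∧ ∀ t ∈ Ioo a' b', v t ≠ 0 := by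
  have hsub : Icc a b ⊆ Icc 0 (π / 2) := Icc_subset_Icc ha hb
  have hc : ContinuousOn v (Icc a b) := h.cont_snd.mono hsub
  obtain ⟨c, hcm, hc0⟩ : ∃ c ∈ Ioo a b, v c ≠ 0 := by
    by_contra! hcon
    obtain ⟨c, hcm⟩ := nonempty_Ioo.2 hab
    have hcm' : c ∈ Ioc (0 : ℝ) (π / 2) := ⟨ha.trans_lt hcm.1, hcm.2.le.trans hb⟩
    have hs := sin_pos_of_mem hcm'
    have heq : v =ᶠ[nhds c] fun _ => 0 := by
      filter_upwards [Ioo_mem_nhds hcm.1 hcm.2] with t ht using hcon t ht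
    have := (h.deriv_snd c hcm').unique ((hasDerivAt_const c (0 : ℝ)).congr_of_eventuallyEq heq)
    exact (mul_ne_zero (mul_ne_zero (neg_ne_zero.2 hA.ne') (by positivity))
      (h.fst_ne_zero hA hcm' (hcon c hcm))) this
  have hcompact : ∀ x y, a ≤ x → y ≤ b → IsCompact (Icc x y ∩ v ⁻¹' {0}) := fun x y hx hy =>
    isCompact_Icc.of_isClosed_subset
      ((hc.mono (Icc_subset_Icc hx hy)).preimage_isClosed_of_isClosed isClosed_Icc
        isClosed_singleton) inter_subset_left
  obtain ⟨a', ⟨⟨ha1, ha2⟩, ha3⟩, hamax⟩ := (hcompact a c le_rfl hcm.2.le).exists_isGreatest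
    ⟨a, ⟨le_rfl, hcm.1.le⟩, hva⟩
  obtain ⟨b', ⟨⟨hb1, hb2⟩, hb3⟩, hbmin⟩ := (hcompact c b hcm.1.le le_rfl).exists_isLeast
    ⟨b, ⟨hcm.2.le, le_rfl⟩, hvb⟩
  have hac : a' < c := lt_of_le_of_ne ha2 (by rintro rfl; exact hc0 ha3)
  have hcb : c < b' := lt_of_le_of_ne hb1 (by rintro rfl; exact hc0 hb3)
  refine ⟨a', b', ha1, hac.trans hcb, hb2, ha3, hb3, fun t ht h0 => ?_⟩
  rcases le_total t c with htc | htc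
  · exact (hamax ⟨⟨ha1.trans ht.1.le, htc⟩, h0⟩).not_gt ht.1
  · exact (hbmin ⟨⟨htc, ht.2.le.trans hb2⟩, h0⟩).not_gt ht.2

/-- Sturm comparison: between two zeros of `v` there is a zero of `V`. -/
lemma exists_zero (h : IsLinSystem p A w v) (H : IsLinSystem p B W V) (hA : 0 < A)
    (hAB : A ≤ B) {a b : ℝ} (ha : 0 ≤ a) (hab : a < b) (hb : b ≤ π / 2) (hva : v a = 0)
    (hvb : v b = 0) : ∃ c, a < c ∧ c ≤ b ∧ (A < B → c < b) ∧ V c = 0 := by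
  obtain ⟨a', b', haa, hab', hbb, hva', hvb', hne⟩ :=
    h.exists_nodal_interval hA ha hab hb hva hvb
  by_cases hV : ∃ t ∈ Ioo a' b', V t = 0
  · obtain ⟨t, ht, h0⟩ := hV
    exact ⟨t, haa.trans_lt ht.1, (ht.2.trans_le hbb).le, fun _ => ht.2.trans_le hbb, h0⟩
  push Not at hV
  have hsub : Ioo a' b' ⊆ Icc 0 (π / 2) := fun t ht =>
    ⟨ha.trans (haa.trans ht.1.le), ht.2.le.trans (hbb.trans hb)⟩
  have key : A = B ∧ V b' = 0 := by
    have ha' := ha.trans haa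
    have hb' := hbb.trans hb
    rcases pos_or_neg_of_ne_zero (h.cont_snd.mono hsub) hne with h1 | h1 <;>
    rcases pos_or_neg_of_ne_zero (H.cont_snd.mono hsub) hV with h2 | h2
    · exact h.comparison_of_pos H hA hAB ha' hab' hb' hva' hvb' h1 h2
    · simpa using h.comparison_of_pos H.neg hA hAB ha' hab' hb' hva' hvb' h1 h2
    · exact h.neg.comparison_of_pos H hA hAB ha' hab' hb' (by simpa) (by simpa) h1 h2
    · simpa using h.neg.comparison_of_pos H.neg hA hAB ha' hab' hb' (by simpa) (by simpa) h1 h2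
  exact ⟨b', haa.trans_lt hab', hbb, fun hlt => absurd key.1 hlt.ne, key.2⟩

end IsLinSystem

/-- If a predicate `Z` holds somewhere in every interval `(a, b]` with endpoints in `S ∪ {0}`,
then it holds at at least `#S` points. -/
lemma exists_finset_card_eq_of_interlacing {Z : ℝ → Prop} (S : Finset ℝ)
    (hS : ∀ b ∈ S, 0 < b)
    (hZ : ∀ a b, (a = 0 ∨ a ∈ S) → b ∈ S → a < b → ∃ c, a < c ∧ c ≤ b ∧ Z c) :
    ∃ T : Finset ℝ, T.card = S.card ∧ ∀ c ∈ T, Z c ∧ 0 < c ∧ ∃ b ∈ S, c ≤ b := by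
  induction S using Finset.induction_on_max with
  | empty => exact ⟨∅, rfl, by simp⟩
  | insert b S hb ih =>
    obtain ⟨T, hcard, hT⟩ := ih (fun x hx => hS x (Finset.mem_insert_of_mem hx))
      (fun x y hx hy => hZ x y (hx.imp_right Finset.mem_insert_of_mem)
        (Finset.mem_insert_of_mem hy))
    obtain ⟨a, ha, hamax⟩ : ∃ a, (a = 0 ∨ a ∈ S) ∧ ∀ x ∈ insert 0 S, x ≤ a :=
      ⟨(insert 0 S).max' (by simp), by simpa using (insert 0 S).max'_mem (by simp),
        fun x hx => Finset.le_max' _ x hx⟩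
    have hab : a < b := by
      rcases ha with rfl | ha
      · exact hS b (Finset.mem_insert_self _ _)
      · exact hb a ha
    obtain ⟨c, hac, hcb, hc⟩ :=
      hZ a b (ha.imp_right Finset.mem_insert_of_mem) (Finset.mem_insert_self _ _) hab
    have hcT : c ∉ T := fun hmem => by
      obtain ⟨-, -, y, hy, hcy⟩ := hT c hmem
      linarith [hamax y (Finset.mem_insert_of_mem hy)]
    refine ⟨insert c T, ?_, ?_⟩
    · rw [Finset.card_insert_of_notMem hcT, hcard,
        Finset.card_insert_of_notMem fun hmem => (hb b hmem).false]
    · intro x hx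
      rcases Finset.mem_insert.1 hx with rfl | hx
      · exact ⟨hc, (hamax 0 (by simp)).trans_lt hac, b, by simp, hcb⟩
      · obtain ⟨h1, h2, y, hy, h3⟩ := hT x hx
        exact ⟨h1, h2, y, Finset.mem_insert_of_mem hy, h3⟩

namespace IsLinSystem

variable {p : ℕ} {A B : ℝ} {w v W V : ℝ → ℝ}

lemma exists_finset_zeros_of_lt (h : IsLinSystem p A w v) (H : IsLinSystem p B W V)
    (S : Finset ℝ) (hA0 : S.Nonempty → 0 < A) (hAB : A < B)
    (hS : ∀ t ∈ S, t ∈ Ioc (0 : ℝ) (π / 2) ∧ v t = 0) :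
    ∃ T : Finset ℝ, T.card = S.card ∧ ∀ t ∈ T, t ∈ Ioo (0 : ℝ) (π / 2) ∧ V t = 0 := by
  obtain ⟨T, hcard, hT⟩ := exists_finset_card_eq_of_interlacing
    (Z := fun t => t < π / 2 ∧ V t = 0) S (fun b hb => (hS b hb).1.1) <| by
      intro a b ha hb hab
      have ha' : 0 ≤ a ∧ v a = 0 := by
        rcases ha with rfl | ha
        · exact ⟨le_rfl, h.snd_zero⟩
        · exact ⟨(hS a ha).1.1.le, (hS a ha).2⟩
      obtain ⟨c, hac, hcb, hlt, hc⟩ := h.exists_zero H (hA0 ⟨b, hb⟩) hAB.le ha'.1 hab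
        (hS b hb).1.2 ha'.2 (hS b hb).2
      exact ⟨c, hac, hcb, (hlt hAB).trans_le (hS b hb).1.2, hc⟩
  exact ⟨T, hcard, fun t ht => ⟨⟨(hT t ht).2.1, (hT t ht).1.1⟩, (hT t ht).1.2⟩⟩

lemma exists_finset_zeros_of_le (h : IsLinSystem p A w v) (H : IsLinSystem p B W V)
    (hA : 0 < A) (hAB : A ≤ B) (S : Finset ℝ)
    (hS : ∀ t ∈ S, t ∈ Ioo (0 : ℝ) (π / 2) ∧ v t = 0) :
    ∃ T : Finset ℝ, T.card = S.card ∧ ∀ t ∈ T, t ∈ Ioo (0 : ℝ) (π / 2) ∧ V t = 0 := by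
  obtain ⟨T, hcard, hT⟩ := exists_finset_card_eq_of_interlacing
    (Z := fun t => V t = 0) S (fun b hb => (hS b hb).1.1) <| by
      intro a b ha hb hab
      have ha' : 0 ≤ a ∧ v a = 0 := by
        rcases ha with rfl | ha
        · exact ⟨le_rfl, h.snd_zero⟩
        · exact ⟨(hS a ha).1.1.le, (hS a ha).2⟩
      obtain ⟨c, hac, hcb, -, hc⟩ := h.exists_zero H hA hAB ha'.1 hab
        (hS b hb).1.2.le ha'.2 (hS b hb).2
      exact ⟨c, hac, hcb, hc⟩
  refine ⟨T, hcard, fun t ht => ?_⟩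
  obtain ⟨h1, h2, b, hb, h3⟩ := hT t ht
  exact ⟨⟨h2, h3.trans_lt (hS b hb).1.2⟩, h1⟩

end IsLinSystem

open Polynomial in
/-- The Gegenbauer polynomial of degree `k` for the weight `(1 - x ^ 2) ^ ((p - 1) / 2)`,
normalized to have value `1` at `1`. -/
noncomputable def gegenbauer (p : ℕ) : ℕ → ℝ[X]
  | 0 => 1
  | k + 1 => X * gegenbauer p k
      - C ((k + p : ℝ)⁻¹) * ((1 - X ^ 2) * derivative (gegenbauer p k))

namespace gegenbauer

open Polynomial

variable {p : ℕ}

lemma natDegree_le (p k : ℕ) : (gegenbauer p k).natDegree ≤ k := by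
  induction k with
  | zero => simp [gegenbauer]
  | succ k ih =>
    rw [gegenbauer]
    have h1 : (X * gegenbauer p k).natDegree ≤ k + 1 := by
      refine natDegree_mul_le.trans ?_
      have : (X : ℝ[X]).natDegree ≤ 1 := natDegree_X_le
      omega
    have h2 : (1 - X ^ 2 : ℝ[X]).natDegree ≤ 2 := by compute_degree
    rcases k.eq_zero_or_pos with rfl | hk
    · simp [gegenbauer]
    refine (natDegree_sub_le_of_le h1 (natDegree_C_mul_le _ _)).trans (max_le le_rfl ?_)
    refine natDegree_mul_le.trans ?_
    have := natDegree_derivative_le (gegenbauer p k)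
    omega

lemma eval_one (p k : ℕ) : (gegenbauer p k).eval 1 = 1 := by
  induction k with
  | zero => simp [gegenbauer]
  | succ k ih => simp [gegenbauer, ih]

/-- The Gegenbauer differential equation, together with the derivative of the recursion. -/
lemma ode_and_derivative_succ (hp : 1 ≤ p) (k : ℕ) :
    ((1 - X ^ 2) * derivative (derivative (gegenbauer p k))
      - C (p + 1 : ℝ) * X * derivative (gegenbauer p k)
      + C (k * (k + p) : ℝ) * gegenbauer p k = 0) ∧
    derivative (gegenbauer p (k + 1)) = C (k + 1 : ℝ) * (gegenbauer p k
      + C ((k + p : ℝ)⁻¹) * (X * derivative (gegenbauer p k))) := by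
  have hinv : ∀ k : ℕ, (C ((k + p : ℝ)⁻¹) * (k + p) : ℝ[X]) = 1 := by
    intro k
    have : (k + p : ℝ) ≠ 0 := by positivity
    rw [show (k + p : ℝ[X]) = C (k + p : ℝ) by simp, ← C_mul, inv_mul_cancel₀ this, C_1]
  have hder : ∀ k : ℕ, ((1 - X ^ 2) * derivative (derivative (gegenbauer p k))
      - C (p + 1 : ℝ) * X * derivative (gegenbauer p k)
      + C (k * (k + p) : ℝ) * gegenbauer p k = 0) →
    derivative (gegenbauer p (k + 1)) = C (k + 1 : ℝ) * (gegenbauer p k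
      + C ((k + p : ℝ)⁻¹) * (X * derivative (gegenbauer p k))) := by
    intro k hk
    rw [gegenbauer]
    have h := hinv k
    simp only [map_add, map_mul, map_natCast, map_one, derivative_sub, derivative_mul,
      derivative_X, derivative_C, derivative_one, derivative_X_pow] at hk ⊢
    linear_combination -C ((k + p : ℝ)⁻¹) * hk
      + (k * gegenbauer p k - X * derivative (gegenbauer p k)) * h
  suffices h : _ from ⟨h, hder k h⟩
  induction k with
  | zero => simp [gegenbauer]
  | succ k ih =>
    have h := hinv k
    rw [hder k ih, gegenbauer]
    simp only [map_add, map_mul, map_natCast, map_one, derivative_mul,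
      derivative_X, derivative_C, derivative_one, derivative_natCast, Nat.cast_add,
      Nat.cast_one] at ih ⊢
    linear_combination (k + 1) * C ((k + p : ℝ)⁻¹) * X * ih
      - (k + 1) * ((1 - X ^ 2) * derivative (gegenbauer p k) + k * X * gegenbauer p k) * h

lemma eval_neg (hp : 1 ≤ p) (k : ℕ) (x : ℝ) :
    (gegenbauer p k).eval (-x) = (-1) ^ k * (gegenbauer p k).eval x ∧
    (derivative (gegenbauer p k)).eval (-x) =
      (-1) ^ (k + 1) * (derivative (gegenbauer p k)).eval x := by
  induction k with
  | zero => simp [gegenbauer]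
  | succ k ih =>
    rw [(ode_and_derivative_succ hp k).2, gegenbauer]
    simp only [eval_sub, eval_mul, eval_add, eval_X, eval_C, Polynomial.eval_one, eval_pow,
      ih.1, ih.2]
    constructor <;> ring

lemma derivative_ne_zero (hp : 1 ≤ p) {k : ℕ} (hk : 1 ≤ k) :
    derivative (gegenbauer p k) ≠ 0 := by
  intro h
  have hode := congrArg (eval 1) (ode_and_derivative_succ hp k).1
  simp only [h, derivative_zero, mul_zero, sub_zero, zero_add, eval_mul, eval_C,
    gegenbauer.eval_one, mul_one, eval_zero] at hode
  have : (0 : ℝ) < k * (k + p) := by positivity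
  exact this.ne' hode

/-- The derivative of an even Gegenbauer polynomial of degree `2 (n + 1)` has at most `n` positive
zeros. -/
lemma card_le_of_derivative_eq_zero (hp : 1 ≤ p) (n : ℕ) (S : Finset ℝ)
    (hS : ∀ x ∈ S, 0 < x ∧ (derivative (gegenbauer p (2 * (n + 1)))).eval x = 0) :
    S.card ≤ n := by
  have hne := derivative_ne_zero hp (k := 2 * (n + 1)) (by omega)
  have hdisj : Disjoint S (S.image fun x => -x) := by
    rw [Finset.disjoint_left]
    rintro x hx hx'
    obtain ⟨y, hy, rfl⟩ := Finset.mem_image.1 hx'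
    linarith [(hS y hy).1, (hS _ hx).1]
  have hsub : S ∪ S.image (fun x => -x) ⊆
      (derivative (gegenbauer p (2 * (n + 1)))).roots.toFinset := by
    intro x hx
    rw [Multiset.mem_toFinset, mem_roots hne, IsRoot.def]
    rcases Finset.mem_union.1 hx with hx | hx
    · exact (hS x hx).2
    · obtain ⟨y, hy, rfl⟩ := Finset.mem_image.1 hx
      rw [(eval_neg hp _ y).2, (hS y hy).2, mul_zero]
  have h1 := Finset.card_le_card hsub
  rw [Finset.card_union_of_disjoint hdisj, Finset.card_image_of_injective _ neg_injective] at h1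
  have h2 := (derivative (gegenbauer p (2 * (n + 1)))).roots.toFinset_card_le
  have h3 := card_roots' (derivative (gegenbauer p (2 * (n + 1))))
  have h4 := natDegree_derivative_le (gegenbauer p (2 * (n + 1)))
  have h5 := natDegree_le p (2 * (n + 1))
  omega

lemma isLinSystem (hp : 1 ≤ p) (k : ℕ) :
    IsLinSystem p (k * (k + p)) (fun t => (gegenbauer p k).eval (cos t))
      (fun t => sin t ^ p * (-sin t * (derivative (gegenbauer p k)).eval (cos t))) where
  cont_fst := by fun_prop
  cont_snd := by fun_prop
  fst_zero := by simp [eval_one]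
  snd_zero := by simp
  deriv_fst t ht := by
    have hs := IsLinSystem.sin_pos_of_mem ht
    refine (((gegenbauer p k).hasDerivAt (cos t)).comp t (hasDerivAt_cos t)).congr_deriv ?_
    field_simp
  deriv_snd t ht := by
    have hs := IsLinSystem.sin_pos_of_mem ht
    have hode := congrArg (eval (cos t)) (ode_and_derivative_succ hp k).1
    simp only [eval_sub, eval_mul, eval_add, eval_X, eval_C, Polynomial.eval_one, eval_pow,
      eval_zero] at hode
    refine (((hasDerivAt_sin t).pow p).mul ((hasDerivAt_sin t).neg.mul
      (((derivative (gegenbauer p k)).hasDerivAt (cos t)).comp t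
        (hasDerivAt_cos t)))).congr_deriv ?_
    obtain ⟨q, rfl⟩ : ∃ q, p = q + 1 := ⟨p - 1, by omega⟩
    have hsq := sin_sq_add_cos_sq t
    push_cast at hode ⊢
    simp only [Pi.pow_apply, Pi.neg_apply, Pi.mul_apply, Function.comp_apply]
    linear_combination sin t ^ (q + 1) * hode
      + sin t ^ (q + 1) * eval (cos t) (derivative (derivative (gegenbauer (q + 1) k))) * hsq

end gegenbauer

lemma gegenbauer.exists_finset_zeros {p : ℕ} (hp : 1 ≤ p) (n : ℕ) :
    ∃ S : Finset ℝ, S.card = n ∧ ∀ t ∈ S, t ∈ Ioc (0 : ℝ) (π / 2) ∧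
      sin t ^ p * (-sin t * (Polynomial.derivative (gegenbauer p (2 * n))).eval (cos t)) = 0 := by
  induction n with
  | zero => exact ⟨∅, by simp⟩
  | succ n ih =>
    obtain ⟨S, hcard, hS⟩ := ih
    obtain ⟨T, hTcard, hT⟩ := (gegenbauer.isLinSystem hp (2 * n)).exists_finset_zeros_of_lt
      (gegenbauer.isLinSystem hp (2 * (n + 1))) S
      (fun hne => by
        have : 0 < n := hcard ▸ hne.card_pos
        positivity)
      (by push_cast; gcongr <;> simp) hS
    refine ⟨insert (π / 2) T, ?_, ?_⟩
    · rw [Finset.card_insert_of_notMem fun h => (hT _ h).1.2.false, hTcard, hcard]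
    · intro t ht
      rcases Finset.mem_insert.1 ht with rfl | ht
      · refine ⟨⟨by positivity, le_rfl⟩, ?_⟩
        have h := (gegenbauer.eval_neg hp (2 * (n + 1)) 0).2
        rw [pow_succ, pow_mul] at h
        simp only [neg_zero, even_two, Even.neg_pow, one_pow, one_mul, neg_mul] at h
        rw [cos_pi_div_two, show Polynomial.eval 0 _ = (0 : ℝ) by linarith]
        simp
      · exact ⟨⟨(hT t ht).1.1, (hT t ht).1.2.le⟩, (hT t ht).2⟩

lemma IsNormalizedLinSolution.isLinSystem {m : ℕ} {A : ℝ} {w : ℝ → ℝ} (hm : 2 ≤ m)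
    (hw : IsNormalizedLinSolution m A w) :
    IsLinSystem (m - 1) A w fun t => sin t ^ (m - 1) * deriv w t := by
  obtain ⟨q, rfl⟩ : ∃ q, m = q + 2 := ⟨m - 2, by omega⟩
  obtain ⟨hc, hd, hd2, h0, hd0, hode⟩ := hw
  have hpi := pi_pos
  simp only [show q + 2 - 1 = q + 1 by omega]
  have hmem : ∀ t ∈ Ioc (0 : ℝ) (π / 2), t ∈ Ioo (0 : ℝ) π := fun t ht =>
    ⟨ht.1, by linarith [ht.2]⟩
  set v : ℝ → ℝ := fun t => sin t ^ (q + 1) * deriv w t with hv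
  have hdv : ∀ t ∈ Ioc (0 : ℝ) (π / 2), HasDerivAt v (-A * sin t ^ (q + 1) * w t) t := by
    intro t ht
    have hs := IsLinSystem.sin_pos_of_mem ht
    refine (((hasDerivAt_sin t).pow (q + 1)).mul
      (hd2 t (hmem t ht)).hasDerivAt).congr_deriv ?_
    have h := hode t (hmem t ht)
    rw [show deriv (deriv w) t = -((((q + 2 : ℕ) : ℝ) - 1) * (cos t / sin t) * deriv w t
      + A * w t) by linarith]
    simp only [Pi.pow_apply, add_tsub_cancel_right]
    push_cast
    field_simp
    ring
  have hcw : ContinuousOn w (Icc 0 (π / 2)) := hc.mono (Icc_subset_Icc_right (by linarith))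
  obtain ⟨K, hK⟩ := isCompact_Icc.exists_bound_of_continuousOn
    (f := fun t => -A * sin t ^ (q + 1) * w t) (s := Icc 0 (π / 2)) (by fun_prop)
  have hbound : ∀ t ∈ Ioc (0 : ℝ) (π / 2), |v t| ≤ K * t := by
    intro t ht
    refine le_of_forall_pos_le_add fun ε hε => ?_
    have hlim := (hasDerivAt_iff_tendsto_slope.1
      (hd 0 ⟨le_rfl, hpi.le⟩).hasDerivAt).mono_left (nhdsGT_le_nhdsNE 0)
    rw [hd0] at hlim
    obtain ⟨h, hht, hh⟩ := ((hlim.eventually (Metric.ball_mem_nhds 0 hε)).and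
      (Ioo_mem_nhdsGT ht.1)).exists
    obtain ⟨ξ, hξ, hξs⟩ := exists_deriv_eq_slope w hh.1
      (hc.mono (Icc_subset_Icc_right (by linarith [hh.2, ht.2])))
      (fun x hx => (hd x ⟨hx.1.le, by linarith [hx.2, hh.2, ht.2]⟩).differentiableWithinAt)
    have hvξ : |v ξ| ≤ ε := by
      rw [← slope_def_field] at hξs
      have h1 : |deriv w ξ| ≤ ε := by
        rw [hξs]
        simpa using (mem_ball_zero_iff.1 hht).le
      have h2 : |sin ξ ^ (q + 1)| ≤ 1 := by
        rw [abs_pow]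
        exact pow_le_one₀ (abs_nonneg _) (abs_sin_le_one ξ)
      calc |v ξ| = |sin ξ ^ (q + 1)| * |deriv w ξ| := abs_mul _ _
        _ ≤ 1 * ε := by gcongr
        _ = ε := one_mul ε
    have hsub : ∀ x ∈ Icc ξ t, x ∈ Ioc (0 : ℝ) (π / 2) := fun x hx =>
      ⟨hξ.1.trans_le hx.1, hx.2.trans ht.2⟩
    have hξt : ξ ≤ t := (hξ.2.trans hh.2).le
    have hmvt := (convex_Icc ξ t).norm_image_sub_le_of_norm_hasDerivWithin_le
      (fun x hx => (hdv x (hsub x hx)).hasDerivWithinAt)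
      (fun x hx => hK x (Ioc_subset_Icc_self (hsub x hx)))
      (left_mem_Icc.2 hξt) (right_mem_Icc.2 hξt)
    rw [norm_eq_abs, norm_eq_abs, abs_of_nonneg (by linarith : 0 ≤ t - ξ)] at hmvt
    have hK0 : 0 ≤ K := (norm_nonneg _).trans (hK t (Ioc_subset_Icc_self ht))
    have := abs_sub_abs_le_abs_sub (v t) (v ξ)
    nlinarith [mul_nonneg hK0 hξ.1.le]
  have hv0 : v 0 = 0 := by simp [hv]
  refine ⟨hcw, ?_, by rw [h0]; exact one_ne_zero, hv0, ?_, hdv⟩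
  · intro t ht
    rcases ht.1.eq_or_lt with rfl | ht0
    · rw [ContinuousWithinAt, hv0]
      have hlim : Filter.Tendsto (fun t : ℝ => K * t) (nhdsWithin 0 (Icc 0 (π / 2))) (nhds 0) := by
        have : Filter.Tendsto (fun t : ℝ => K * t) (nhds 0) (nhds (K * 0)) :=
          (continuous_const.mul continuous_id).tendsto 0
        rw [mul_zero] at this
        exact this.mono_left nhdsWithin_le_nhds
      refine squeeze_zero_norm' ?_ hlim
      filter_upwards [self_mem_nhdsWithin] with t ht
      rcases ht.1.eq_or_lt with rfl | ht0
      · simp [hv0]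
      · exact hbound t ⟨ht0, ht.2⟩
    · exact (hdv t ⟨ht0, ht.2⟩).continuousAt.continuousWithinAt
  · intro t ht
    have hs := IsLinSystem.sin_pos_of_mem ht
    refine (hd t (Ioo_subset_Icc_self (hmem t ht))).hasDerivAt.congr_deriv ?_
    simp only [hv]
    field_simp

lemma Set.finite_and_ncard_eq_of_finset {α : Type*} {s : Set α} {n : ℕ}
    (hle : ∀ S : Finset α, ↑S ⊆ s → S.card ≤ n) (hge : ∃ S : Finset α, ↑S ⊆ s ∧ S.card = n) :
    s.Finite ∧ s.ncard = n := by
  have hfin : s.Finite := by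
    by_contra hinf
    obtain ⟨S, hS, hcard⟩ := Set.Infinite.exists_subset_card_eq hinf (n + 1)
    have := hle S hS
    omega
  refine ⟨hfin, le_antisymm ?_ ?_⟩
  · rw [Set.ncard_eq_toFinset_card s hfin]
    exact hle _ (by simp)
  · obtain ⟨S, hS, rfl⟩ := hge
    rw [← Set.ncard_coe_finset]
    exact Set.ncard_le_ncard hS hfin

/-- For `2n(2n+m-1) < A ≤ (2n+2)(2n+2+m-1)`, a normalized solution of the
linearized equation with parameter `A` has exactly `n` local extrema
(equivalently, critical points) in `(0, π/2)`. -/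
theorem linsol_card_critical_points (m n : ℕ) (hm : 2 ≤ m) (A : ℝ)
    (hA1 : (2 * (n : ℝ)) * (2 * (n : ℝ) + (m : ℝ) - 1) < A)
    (hA2 : A ≤ (2 * (n : ℝ) + 2) * (2 * (n : ℝ) + 2 + (m : ℝ) - 1))
    (w : ℝ → ℝ) (hw : IsNormalizedLinSolution m A w) :
    {t ∈ Ioo (0 : ℝ) (π / 2) | deriv w t = 0}.Finite ∧
      {t ∈ Ioo (0 : ℝ) (π / 2) | deriv w t = 0}.ncard = n := by
  have hp : 1 ≤ m - 1 := by omega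
  have hpm : ((m - 1 : ℕ) : ℝ) = m - 1 := by push_cast [show 1 ≤ m by omega]; ring
  have hm' : (2 : ℝ) ≤ m := by exact_mod_cast hm
  have hsys := hw.isLinSystem hm
  have hA : 0 < A :=
    (mul_nonneg (by positivity) (by linarith [n.cast_nonneg (α := ℝ)])).trans_lt hA1
  have hzero : ∀ t ∈ Ioo (0 : ℝ) (π / 2), sin t ^ (m - 1) * deriv w t = 0 → deriv w t = 0 :=
    fun t ht h => (mul_eq_zero.1 h).resolve_left
      (pow_pos (IsLinSystem.sin_pos_of_mem (Ioo_subset_Ioc_self ht)) _).ne'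
  apply Set.finite_and_ncard_eq_of_finset
  · intro S hS
    obtain ⟨T, hcard, hT⟩ := hsys.exists_finset_zeros_of_le
      (gegenbauer.isLinSystem hp (2 * (n + 1))) hA
      (by rw [hpm]; push_cast; linarith) S
      (fun t ht => ⟨(hS ht).1, mul_eq_zero_of_right _ (hS ht).2⟩)
    have hinj : InjOn cos (T : Set ℝ) := by
      refine injOn_cos.mono fun t ht => mem_Icc.2 ?_
      have := (hT t ht).1
      exact ⟨this.1.le, by linarith [this.2, pi_pos]⟩
    rw [← hcard, ← Finset.card_image_of_injOn hinj]
    refine gegenbauer.card_le_of_derivative_eq_zero hp n _ fun x hx => ?_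
    obtain ⟨t, ht, rfl⟩ := Finset.mem_image.1 hx
    obtain ⟨hmem, h0⟩ := hT t ht
    have hs := IsLinSystem.sin_pos_of_mem (Ioo_subset_Ioc_self hmem)
    exact ⟨cos_pos_of_mem_Ioo ⟨by linarith [hmem.1, pi_pos], hmem.2⟩, by simpa [hs.ne'] using h0⟩
  · obtain ⟨S, hcard, hS⟩ := gegenbauer.exists_finset_zeros hp n
    obtain ⟨T, hTcard, hT⟩ := (gegenbauer.isLinSystem hp (2 * n)).exists_finset_zeros_of_lt hsys S
      (fun hne => by
        have : 0 < n := hcard ▸ hne.card_pos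
        positivity)
      (by rw [hpm]; push_cast; linarith) hS
    exact ⟨T, fun t ht => ⟨(hT t ht).1, hzero t (hT t ht).1 (hT t ht).2⟩, hTcard.trans hcard⟩
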